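/- Let m, n, p, N ∈ ℕ with N ≥ 1. For each i ∈ {1,…,N} let A_i be a real m×m matrix, B_i a real m×n matrix, C_i a real n×m matrix, D_i a real n×n matrix, E_i a real p×(m+n) matrix, and U_i a real symmetric p×p matrix all of whose entries are nonnegative. Let P be a real symmetric m×m matrix and a, b, c ∈ ℝ. Suppose for each i ∈ {1,…,N}: for all x ∈ ℝ^m and u ∈ ℝ^n, writing ξ = (x,u) ∈ ℝ^{m+n}, 2·xᵀP(A_i x + B_i u) + (E_i ξ)ᵀU_i(E_i ξ) ≤ a·‖C_i x + D_i u‖² + 2b·(C_i x + D_i u)ᵀu + c·‖u‖². Let u : [0,∞) → ℝ^n, let x : [0,∞) → ℝ^m be differentiable with x(0) = 0 and x(t) → 0 as t → ∞, and let y : [0,∞) → ℝ^n be such that for every t ≥ 0 there exists i ∈ {1,…,N} with E_i·(x(t),u(t)) ≥ 0 componentwise, x'(t) = A_i·x(t) + B_i·u(t), and y(t) = C_i·x(t) + D_i·u(t). Assume t ↦ a·‖y(t)‖² + 2b·y(t)ᵀu(t) + c·‖u(t)‖² is integrable on [0,∞). Then ∫₀^∞ (a·‖y(t)‖² + 2b·y(t)ᵀu(t)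 + c·‖u(t)‖²) dt ≥ 0. -/

import Mathlib

open Matrix MeasureTheory

/-- Derivative of a symmetric quadratic form along a differentiable curve. -/
theorem HasDerivWithinAt.dotProduct_mulVec_self {ι : Type*} [Fintype ι] {P : Matrix ι ι ℝ}
    (hP : P.IsSymm) {x : ℝ → ι → ℝ} {x' : ι → ℝ} {s : Set ℝ} {t : ℝ}
    (hx : HasDerivWithinAt x x' s t) :
    HasDerivWithinAt (fun r => x r ⬝ᵥ P.mulVec (x r)) (2 * (x t ⬝ᵥ P.mulVec x')) s t := by
  have hx_coord := hasDerivWithinAt_pi.1 hx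
  have hPx : ∀ j, HasDerivWithinAt (fun r => P.mulVec (x r) j) (P.mulVec x' j) s t := fun j =>
    HasDerivWithinAt.fun_sum fun k _ => (hx_coord k).const_mul (P j k)
  have hsum : HasDerivWithinAt (fun r => x r ⬝ᵥ P.mulVec (x r))
      (∑ j, (x' j * P.mulVec (x t) j + x t j * P.mulVec x' j)) s t :=
    HasDerivWithinAt.fun_sum fun j _ => (hx_coord j).mul (hPx j)
  have hsymm : x' ⬝ᵥ P.mulVec (x t) = x t ⬝ᵥ P.mulVec x' := by
    rw [dotProduct_mulVec, ← mulVec_transpose, hP.eq, dotProduct_comm]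
  convert hsum using 1
  rw [Finset.sum_add_distrib]
  change _ = x' ⬝ᵥ P.mulVec (x t) + x t ⬝ᵥ P.mulVec x'
  rw [hsymm, two_mul]

/-- A quadratic form with nonnegative coefficients is nonnegative on the nonnegative orthant. -/
theorem Matrix.dotProduct_mulVec_self_nonneg_of_nonneg {ι : Type*} [Fintype ι]
    {U : Matrix ι ι ℝ} (hU : ∀ j k, 0 ≤ U j k) {v : ι → ℝ} (hv : ∀ j, 0 ≤ v j) :
    0 ≤ v ⬝ᵥ U.mulVec v :=
  Finset.sum_nonneg fun j _ => mul_nonneg (hv j)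
    (Finset.sum_nonneg fun k _ => mul_nonneg (hU j k) (hv k))

/-- If the right derivative of `V` is bounded above by an integrable function `φ` on `[a, ∞)`,
then the total increment of `V` is at most the integral of `φ`. -/
theorem sub_le_integral_Ici_of_hasDerivWithinAt_of_tendsto {V V' φ : ℝ → ℝ} {a l : ℝ}
    (hV : ∀ t, a ≤ t → HasDerivWithinAt V (V' t) (Set.Ici a) t)
    (hφ : IntegrableOn φ (Set.Ici a)) (hle : ∀ t, a ≤ t → V' t ≤ φ t)
    (hlim : Filter.Tendsto V Filter.atTop (nhds l)) :
    l - V a ≤ ∫ t in Set.Ici a, φ t := by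
  rw [integral_Ici_eq_integral_Ioi]
  refine le_of_tendsto_of_tendsto (hlim.sub_const (V a)) (intervalIntegral_tendsto_integral_Ioi a
    (hφ.mono_set Set.Ioi_subset_Ici_self) Filter.tendsto_id) ?_
  filter_upwards [Filter.eventually_ge_atTop a] with T hT
  exact intervalIntegral.sub_le_integral_of_hasDeriv_right_of_le_Ico hT
    (fun t ht => (hV t ht.1).continuousWithinAt.mono Set.Icc_subset_Ici_self)
    (fun t ht => (hV t ht.1).mono fun r hr => ht.1.trans (le_of_lt hr))
    (hφ.mono_set Set.Icc_subset_Ici_self) (fun t ht => hle t ht.1)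

/-- Theorem 8 (piecewise linear systems): if for each mode `i` the LMI
`[Aᵢ Bᵢ; I 0]ᵀ[0 P; P 0][Aᵢ Bᵢ; I 0] − Θᵢ(Π) + EᵢᵀUᵢEᵢ ⪯ 0` holds (expressed as a
quadratic-form inequality), with `Uᵢ` symmetric with nonnegative entries, then any
trajectory of the piecewise linear system (which at each time evolves according to a mode
whose flow set `{ξ | Eᵢξ ≥ 0}` contains `(x(t),u(t))`), starting at rest with state
converging to zero, satisfies the IQC `∫₀^∞ (a‖y‖² + 2b yᵀu + c‖u‖²) dt ≥ 0`. -/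
theorem pwl_lmi_implies_iqc {m n p N : ℕ} (hN : 1 ≤ N)
    (A : Fin N → Matrix (Fin m) (Fin m) ℝ) (B : Fin N → Matrix (Fin m) (Fin n) ℝ)
    (C : Fin N → Matrix (Fin n) (Fin m) ℝ) (D : Fin N → Matrix (Fin n) (Fin n) ℝ)
    (E : Fin N → Matrix (Fin p) (Fin (m + n)) ℝ)
    (U : Fin N → Matrix (Fin p) (Fin p) ℝ)
    (hUsymm : ∀ i, (U i).IsSymm) (hUpos : ∀ i, ∀ j k, 0 ≤ U i j k)
    (P : Matrix (Fin m) (Fin m) ℝ) (hP : P.IsSymm) (a b c : ℝ)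
    (hLMI : ∀ i : Fin N, ∀ (x : Fin m → ℝ) (u : Fin n → ℝ),
      2 * (x ⬝ᵥ P.mulVec ((A i).mulVec x + (B i).mulVec u)) +
          ((E i).mulVec (Fin.append x u) ⬝ᵥ (U i).mulVec ((E i).mulVec (Fin.append x u))) ≤
        a * (((C i).mulVec x + (D i).mulVec u) ⬝ᵥ ((C i).mulVec x + (D i).mulVec u)) +
          2 * b * (((C i).mulVec x + (D i).mulVec u) ⬝ᵥ u) + c * (u ⬝ᵥ u))
    (u : ℝ → Fin n → ℝ) (x : ℝ → Fin m → ℝ) (y : ℝ → Fin n → ℝ)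
    (hx0 : x 0 = 0)
    (hxlim : Filter.Tendsto x Filter.atTop (nhds 0))
    -- at every time the trajectory follows some mode whose flow set contains (x(t),u(t))
    (htraj : ∀ t, 0 ≤ t → ∃ i : Fin N,
      (∀ j, 0 ≤ (E i).mulVec (Fin.append (x t) (u t)) j) ∧
        HasDerivWithinAt x ((A i).mulVec (x t) + (B i).mulVec (u t)) (Set.Ici 0) t ∧
        y t = (C i).mulVec (x t) + (D i).mulVec (u t))
    (hint : IntegrableOn
      (fun t => a * (y t ⬝ᵥ y t) + 2 * b * (y t ⬝ᵥ u t) + c * (u t ⬝ᵥ u t)) (Set.Ici 0)) :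
    0 ≤ ∫ t in Set.Ici (0 : ℝ),
      (a * (y t ⬝ᵥ y t) + 2 * b * (y t ⬝ᵥ u t) + c * (u t ⬝ᵥ u t)) := by
  have : Nonempty (Fin N) := ⟨⟨0, hN⟩⟩
  choose! i hflow hderiv hy using htraj
  have hlim : Filter.Tendsto (fun t => x t ⬝ᵥ P.mulVec (x t)) Filter.atTop (nhds 0) := by
    have hcont : Continuous fun v : Fin m → ℝ => v ⬝ᵥ P.mulVec v := by fun_prop
    simpa [Function.comp_def] using (hcont.tendsto 0).comp hxlim
  have hbound := sub_le_integral_Ici_of_hasDerivWithinAt_of_tendsto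
    (fun t ht => (hderiv t ht).dotProduct_mulVec_self hP) hint (fun t ht => ?_) hlim
  · simpa [hx0] using hbound
  · have hU := dotProduct_mulVec_self_nonneg_of_nonneg (hUpos (i t)) (hflow t ht)
    have hmode := hLMI (i t) (x t) (u t)
    rw [← hy t ht] at hmode
    linarith
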